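/- Let U ⊆ ℝ × ℝ be an open set of points (t, x) with x ∈ (−π, π) such that φ(t,x) := arctan((2 tan(x/2) + 1)/√3) − (√3/2) t lies in (−π/2, π/2), and define s(x,t) = 2 arctan((√3 tan(φ(t,x)) − 1)/2) on U. Then the function m(t,x) = (sin(s(x,t)) + 2)/(sin(x) + 2) satisfies the continuity equation ∂ₜm + (sin(x) + 2) ∂ₓm + cos(x) m = 0 on U, with m(0,x) = 1 whenever (0,x) ∈ U. Moreover m(t,x) > 0 on U. -/

import Mathlib

open Real

theorem aux_phi (x : ℝ) (hx : x ∈ Set.Ioo (-π) π) :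
    HasDerivAt (fun y => arctan ((2 * tan (y / 2) + 1) / Real.sqrt 3))
      (Real.sqrt 3 / 2 / (Real.sin x + 2)) x := by
  have hc : 0 < Real.cos (x / 2) :=
    Real.cos_pos_of_mem_Ioo ⟨by linarith [hx.1], by linarith [hx.2]⟩
  have h1 : HasDerivAt (fun y : ℝ => y / 2) (1 / 2) x := (hasDerivAt_id x).div_const 2
  have h2 : HasDerivAt (fun y : ℝ => tan (y / 2)) (1 / Real.cos (x / 2) ^ 2 * (1 / 2)) x :=
    HasDerivAt.comp (h₂ := tan) x (Real.hasDerivAt_tan hc.ne') h1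
  have h3 := (((h2.const_mul 2).add_const 1).div_const (Real.sqrt 3)).arctan
  refine h3.congr_deriv ?_
  have hsx : Real.sin x = 2 * Real.sin (x / 2) * Real.cos (x / 2) := by
    rw [← Real.sin_two_mul]; congr 1; ring
  have hv : 0 < Real.sin x + 2 := by linarith [Real.neg_one_le_sin x]
  rw [hsx] at hv ⊢
  have hsc := Real.sin_sq_add_cos_sq (x / 2)
  rw [Real.tan_eq_sin_div_cos]
  set S := Real.sin (x / 2)
  set C := Real.cos (x / 2)
  have h30 : 0 < Real.sqrt 3 := by positivity
  have h33 : Real.sqrt 3 ^ 2 = 3 := Real.sq_sqrt (by norm_num)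
  have e1 : 1 + ((2 * (S / C) + 1) / Real.sqrt 3) ^ 2 = 2 * (2 * S * C + 2) / (3 * C ^ 2) := by
    rw [div_pow, h33]
    field_simp
    linear_combination 4 * hsc
  rw [e1]
  field_simp
  rw [h33]

/-- With the departure point `s(x,t)` of the velocity field `v(x) = sin x + 2`
defined on an open set `U` as in the paper, the ratio
`m(t,x) = (sin(s(x,t)) + 2)/(sin x + 2)` satisfies the continuity equation
`∂ₜm + (sin x + 2) ∂ₓm + cos(x) m = 0` on `U`, with `m(0,x) = 1` whenever
`(0,x) ∈ U`, and `m > 0` on `U`. -/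
theorem mass_ratio_solves_continuity_equation
    (U : Set (ℝ × ℝ)) (hU : IsOpen U)
    (φ : ℝ → ℝ → ℝ) (s : ℝ → ℝ → ℝ) (m : ℝ → ℝ → ℝ)
    (hφ : ∀ t x, φ t x = arctan ((2 * tan (x / 2) + 1) / Real.sqrt 3)
      - (Real.sqrt 3 / 2) * t)
    (hUx : ∀ p ∈ U, p.2 ∈ Set.Ioo (-π) π)
    (hUφ : ∀ p ∈ U, φ p.1 p.2 ∈ Set.Ioo (-(π / 2)) (π / 2))
    (hs : ∀ t x, s x t = 2 * arctan ((Real.sqrt 3 * tan (φ t x) - 1) / 2))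
    (hm : ∀ t x, m t x = (Real.sin (s x t) + 2) / (Real.sin x + 2)) :
    (∀ p ∈ U,
      deriv (fun τ => m τ p.2) p.1
        + (Real.sin p.2 + 2) * deriv (fun y => m p.1 y) p.2
        + Real.cos p.2 * m p.1 p.2 = 0) ∧
    (∀ x, (0, x) ∈ U → m 0 x = 1) ∧
    (∀ p ∈ U, 0 < m p.1 p.2) := by
  have hv : ∀ x, 0 < Real.sin x + 2 := fun x => by linarith [Real.neg_one_le_sin x]
  have h30 : 0 < Real.sqrt 3 := by positivity
  refine ⟨?_, ?_, ?_⟩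
  · rintro ⟨t, x⟩ hp
    have hx := hUx _ hp
    have hp2 := hUφ _ hp
    simp only at hx hp2 ⊢
    have hc := (Real.cos_pos_of_mem_Ioo hp2).ne'
    obtain ⟨D, hD⟩ : ∃ D, HasDerivAt
        (fun z => Real.sin (2 * arctan ((Real.sqrt 3 * tan z - 1) / 2))) D (φ t x) :=
      ⟨_, ((((((Real.hasDerivAt_tan hc).const_mul (Real.sqrt 3)).sub_const 1).div_const
        2).arctan).const_mul 2).sin⟩
    have ht : HasDerivAt (fun τ => φ τ x) (-(Real.sqrt 3 / 2)) t := by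
      simp only [hφ]
      refine (((hasDerivAt_id t).const_mul (Real.sqrt 3 / 2)).const_sub _).congr_deriv (by ring)
    have hxx : HasDerivAt (fun y => φ t y) (Real.sqrt 3 / 2 / (Real.sin x + 2)) x := by
      simp only [hφ]
      exact (aux_phi x hx).sub_const _
    have h1 : HasDerivAt (fun τ => m τ x) (D * (-(Real.sqrt 3 / 2)) / (Real.sin x + 2)) t := by
      simp only [hm, hs]
      exact ((hD.comp t ht).add_const 2).div_const _
    have h2 : HasDerivAt (fun y => m t y)
        ((D * (Real.sqrt 3 / 2 / (Real.sin x + 2)) * (Real.sin x + 2)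
          - (Real.sin (s x t) + 2) * Real.cos x) / (Real.sin x + 2) ^ 2) x := by
      simp only [hm, hs]
      exact ((hD.comp x hxx).add_const 2).div ((Real.hasDerivAt_sin x).add_const 2) (hv x).ne'
    rw [h1.deriv, h2.deriv, hm]
    have := (hv x).ne'
    field_simp
    ring
  · intro x hp
    have hx := hUx _ hp
    simp only at hx
    have : s x 0 = x := by
      rw [hs, hφ, mul_zero, sub_zero, Real.tan_arctan, mul_div_cancel₀ _ h30.ne',
        add_sub_cancel_right, mul_div_cancel_left₀ _ (two_ne_zero),
        Real.arctan_tan (by linarith [hx.1]) (by linarith [hx.2])]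
      ring
    rw [hm, this, div_self (hv x).ne']
  · intro p _
    rw [hm]
    exact div_pos (hv _) (hv _)
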